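/- arXiv:1904.05001 — 2 statements merged into one kernel-verified Lean document; each statement's English description precedes it below -/
import Mathlib

section
/- (Proposition 1, bi-separable case.) Let 𝒫 = {A_1, …, A_m} be a partition of V into m ≥ 2 nonempty parts and g the graph state of G. Then every 𝒫-bi-separable density matrix ρ satisfies ⟨g, ρ g⟩ ≤ max_A 2^{−r(A)}, where the maximum is over all nonempty proper unions of parts A of 𝒫. -/
open Matrix Finset
open scoped Classical ComplexOrder

noncomputable section

variable {V : Type} [Fintype V] [DecidableEq V]

/-- The indicator function δ_i : V → ZMod 2 of a vertex `i`. -/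
def delta (i : V) : V → ZMod 2 := fun v => if v = i then 1 else 0

/-- The stabilizer `S_i = X_i ⊗_{j ∈ N(i)} Z_j` of the graph `G` at vertex `i`,
as a matrix acting on the N-qubit Hilbert space `(V → ZMod 2) → ℂ`:
`(S_i ψ)(x) = (-1)^{∑_{j ∈ N(i)} x(j)} ψ(x + δ_i)`. -/
def stab (G : SimpleGraph V) (i : V) : Matrix (V → ZMod 2) (V → ZMod 2) ℂ :=
  Matrix.of fun x y =>
    if y = x + delta i then ((-1 : ℂ) ^ (∑ j ∈ univ.filter (fun j => G.Adj i j), (x j).val))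
    else 0

/-- The number of edges `{i,j}` of `G` with `x i = x j = 1`. -/
def edgeCount (G : SimpleGraph V) (x : V → ZMod 2) : ℕ :=
  (G.edgeFinset.filter (fun e => ∀ v ∈ e, x v = 1)).card

/-- The graph state of `G`: `g(x) = 2^{-N/2} (-1)^{e(x)}`. -/
def graphState (G : SimpleGraph V) : (V → ZMod 2) → ℂ :=
  fun x => ((-1 : ℂ) ^ edgeCount G x) / ((Real.sqrt 2 ^ Fintype.card V : ℝ) : ℂ)

/-- The stabilizer projector `∏_{i ∈ W} (S_i + I)/2` (the factors pairwise commute, so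
the order of multiplication is irrelevant; we use the canonical enumeration of `W`). -/
def stabProj (G : SimpleGraph V) (W : Finset V) : Matrix (V → ZMod 2) (V → ZMod 2) ℂ :=
  (W.toList.map (fun i => (2:ℂ)⁻¹ • (stab G i + 1))).prod

/-- The off-diagonal adjacency block `Γ_{A,Ā}` over `ZMod 2`. -/
def gammaMat (G : SimpleGraph V) (A : Finset V) :
    Matrix {v // v ∈ A} {v // v ∉ A} (ZMod 2) :=
  Matrix.of fun i j => if G.Adj i.1 j.1 then 1 else 0

/-- `r(A)`: the rank of `Γ_{A,Ā}` over `ZMod 2`. -/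
def gRank (G : SimpleGraph V) (A : Finset V) : ℕ := (gammaMat G A).rank

/-- Restriction of a computational-basis label to a subset `A`. -/
def restrictTo (A : Finset V) (x : V → ZMod 2) : {v // v ∈ A} → ZMod 2 := fun v => x v.1

/-- Restriction of a computational-basis label to the complement of `A`. -/
def restrictOut (A : Finset V) (x : V → ZMod 2) : {v // v ∉ A} → ZMod 2 := fun v => x v.1

/-- `ψ` is a product vector across the bipartition `{A, V \ A}`. -/
def IsProdVec (A : Finset V) (ψ : (V → ZMod 2) → ℂ) : Prop :=
  ∃ (φ : ({v // v ∈ A} → ZMod 2) → ℂ) (χ : ({v // v ∉ A} → ZMod 2) → ℂ),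
    ∀ x, ψ x = φ (restrictTo A x) * χ (restrictOut A x)

/-- `P : Fin m → Finset V` is a partition of `V` into `m` nonempty disjoint subsets. -/
def IsPartition {m : ℕ} (P : Fin m → Finset V) : Prop :=
  (∀ t, (P t).Nonempty) ∧ (∀ t t', t ≠ t' → Disjoint (P t) (P t')) ∧
    univ.biUnion P = univ

/-- `ψ` is a unit vector: `⟨ψ, ψ⟩ = 1`. -/
def IsUnit' (ψ : (V → ZMod 2) → ℂ) : Prop := star ψ ⬝ᵥ ψ = 1

/-- A pure state fully separable with respect to the partition `P`:
`ψ(x) = ∏_t φ_t(x|_{A_t})`. -/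
def FullSepPure {m : ℕ} (P : Fin m → Finset V) (ψ : (V → ZMod 2) → ℂ) : Prop :=
  ∃ φ : (t : Fin m) → ({v // v ∈ P t} → ZMod 2) → ℂ,
    ∀ x, ψ x = ∏ t, φ t (restrictTo (P t) x)

/-- A `P`-fully separable density matrix. -/
def FullSep {m : ℕ} (P : Fin m → Finset V) (ρ : Matrix (V → ZMod 2) (V → ZMod 2) ℂ) : Prop :=
  ∃ (M : ℕ) (p : Fin M → ℝ) (ψ : Fin M → ((V → ZMod 2) → ℂ)),
    (∀ i, 0 ≤ p i) ∧ (∑ i, p i) = 1 ∧ (∀ i, IsUnit' (ψ i)) ∧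
    (∀ i, FullSepPure P (ψ i)) ∧
    ρ = ∑ i, (p i : ℂ) • vecMulVec (ψ i) (star (ψ i))

/-- A `P`-bi-separable density matrix: a convex mixture of unit vectors each of which is a
product vector across `{A, V \ A}` for some nonempty proper union of parts `A` of `P`. -/
def BiSep {m : ℕ} (P : Fin m → Finset V) (ρ : Matrix (V → ZMod 2) (V → ZMod 2) ℂ) : Prop :=
  ∃ (M : ℕ) (p : Fin M → ℝ) (ψ : Fin M → ((V → ZMod 2) → ℂ)),
    (∀ i, 0 ≤ p i) ∧ (∑ i, p i) = 1 ∧ (∀ i, IsUnit' (ψ i)) ∧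
    (∀ i, ∃ S : Finset (Fin m), S.Nonempty ∧ S ≠ univ ∧ IsProdVec (S.biUnion P) (ψ i)) ∧
    ρ = ∑ i, (p i : ℂ) • vecMulVec (ψ i) (star (ψ i))

/-- An `m`-separable density matrix: a convex mixture of unit vectors each of which is
fully separable with respect to some partition of `V` into `m` nonempty parts. -/
def MSep (m : ℕ) (ρ : Matrix (V → ZMod 2) (V → ZMod 2) ℂ) : Prop :=
  ∃ (M : ℕ) (p : Fin M → ℝ) (ψ : Fin M → ((V → ZMod 2) → ℂ)),
    (∀ i, 0 ≤ p i) ∧ (∑ i, p i) = 1 ∧ (∀ i, IsUnit' (ψ i)) ∧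
    (∀ i, ∃ P : Fin m → Finset V, IsPartition P ∧ FullSepPure P (ψ i)) ∧
    ρ = ∑ i, (p i : ℂ) • vecMulVec (ψ i) (star (ψ i))

/-- A proper `k`-coloring of `G` with color classes `C 0, …, C (k-1)`:
the classes are disjoint, cover `V`, and each is an independent set. -/
def IsColoring (G : SimpleGraph V) {k : ℕ} (C : Fin k → Finset V) : Prop :=
  (∀ l l', l ≠ l' → Disjoint (C l) (C l')) ∧ univ.biUnion C = univ ∧
    ∀ l, ∀ i ∈ C l, ∀ j ∈ C l, ¬ G.Adj i j

/-- A density matrix: Hermitian positive semidefinite with trace 1. -/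
def IsDensity (ρ : Matrix (V → ZMod 2) (V → ZMod 2) ℂ) : Prop :=
  ρ.PosSemidef ∧ ρ.trace = 1

/-- Glue `a : A → ZMod 2` and `b : Ā → ZMod 2` into a function on `V`. -/
def glue (A : Finset V) (a : {v // v ∈ A} → ZMod 2) (b : {v // v ∉ A} → ZMod 2) :
    V → ZMod 2 := fun v => if h : v ∈ A then a ⟨v, h⟩ else b ⟨v, h⟩

/-- The reduced density matrix `ρ_A` of a pure state `ψ`. -/
def rdm (A : Finset V) (ψ : (V → ZMod 2) → ℂ) :
    Matrix ({v // v ∈ A} → ZMod 2) ({v // v ∈ A} → ZMod 2) ℂ :=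
  Matrix.of fun a a' => ∑ b : {v // v ∉ A} → ZMod 2,
    ψ (glue A a b) * (starRingEnd ℂ) (ψ (glue A a' b))


/-- The star graph on `Fin N` (center `0`, i.e. vertex labelled 1). -/
def starGraph (N : ℕ) : SimpleGraph (Fin N) :=
  SimpleGraph.fromRel (fun i _ => (i : ℕ) = 0)

/-- The path graph on `Fin N` (vertex `v` represents the label `v+1`). -/
def pathGraph (N : ℕ) : SimpleGraph (Fin N) :=
  SimpleGraph.fromRel (fun a b => (a : ℕ) + 1 = (b : ℕ))

/-- The `n × n` grid graph. -/
def gridGraph (n : ℕ) : SimpleGraph (Fin n × Fin n) :=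
  SimpleGraph.fromRel (fun a b => Nat.dist (a.1 : ℕ) (b.1 : ℕ) + Nat.dist (a.2 : ℕ) (b.2 : ℕ) = 1)

/-- The number of edges of `G` crossing the bipartition `{A, V \ A}` (each such edge is
counted once, as the ordered pair whose first component lies in `A`). -/
def crossCount {W : Type} [Fintype W] [DecidableEq W] (G : SimpleGraph W) (A : Finset W) : ℕ :=
  ((univ ×ˢ univ).filter fun p : W × W => G.Adj p.1 p.2 ∧ p.1 ∈ A ∧ p.2 ∉ A).card

/-- The nontrivial character `z ↦ (-1)^z` of `ZMod 2`. -/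
def signChar : AddChar (ZMod 2) ℂ := AddChar.zmodChar 2 (ζ := (-1 : ℂ)) (by norm_num)

lemma signChar_natCast (n : ℕ) : signChar (n : ZMod 2) = (-1) ^ n :=
  AddChar.zmodChar_apply' _ n

lemma signChar_eq_one_or (z : ZMod 2) : signChar z = 1 ∨ signChar z = -1 := by
  rw [← ZMod.natCast_zmod_val z, signChar_natCast]
  exact neg_one_pow_eq_or ℂ _

lemma star_signChar (z : ZMod 2) : (starRingEnd ℂ) (signChar z) = signChar z := by
  rcases signChar_eq_one_or z with h | h <;> simp [h]

lemma norm_signChar (z : ZMod 2) : ‖signChar z‖ = 1 := by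
  rcases signChar_eq_one_or z with h | h <;> simp [h]

lemma signChar_eq_one_iff (z : ZMod 2) : signChar z = 1 ↔ z = 0 := by
  constructor
  · intro h
    by_contra hz
    have h1 : ∀ w : ZMod 2, w ≠ 0 → w = ((1 : ℕ) : ZMod 2) := by decide
    rw [h1 z hz, signChar_natCast] at h
    norm_num at h
  · rintro rfl
    exact AddChar.map_zero_eq_one _

/-- Orthogonality of the characters of `(ZMod 2)^α`. -/
lemma sum_signChar_dotProduct {α : Type*} [Fintype α] [DecidableEq α] (c : α → ZMod 2) :
    ∑ a : α → ZMod 2, signChar (a ⬝ᵥ c) = if c = 0 then (2 : ℂ) ^ Fintype.card α else 0 := by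
  let f : (α → ZMod 2) →+ ZMod 2 :=
    AddMonoidHom.mk' (fun a => a ⬝ᵥ c) (fun a b => add_dotProduct a b c)
  have hf : ∀ a, (signChar.compAddMonoidHom f) a = signChar (a ⬝ᵥ c) := fun a => rfl
  simp_rw [← hf, AddChar.sum_eq_ite]
  have h0 : signChar.compAddMonoidHom f = 0 ↔ c = 0 := by
    constructor
    · intro h
      ext i
      have hi := DFunLike.congr_fun h (Pi.single i 1)
      rw [hf, AddChar.zero_apply, signChar_eq_one_iff, single_dotProduct, one_mul] at hi
      exact hi
    · rintro rfl
      ext a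
      rw [hf]
      simp
  simp [h0]

/-- The kernel of a matrix over `ZMod 2` has `2 ^ (|β| - rank)` elements. -/
lemma card_ker_mul_two_pow_rank {α β : Type*} [Fintype α] [Fintype β] [DecidableEq β]
    (M : Matrix α β (ZMod 2)) :
    (univ.filter fun k : β → ZMod 2 => M *ᵥ k = 0).card * 2 ^ M.rank
      = 2 ^ Fintype.card β := by
  have h1 : (univ.filter fun k : β → ZMod 2 => M *ᵥ k = 0).card
      = 2 ^ Module.finrank (ZMod 2) (LinearMap.ker M.mulVecLin) := by
    have h := Module.card_eq_pow_finrank (K := ZMod 2) (V := LinearMap.ker M.mulVecLin)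
    rw [ZMod.card] at h
    rw [← h, Fintype.card_subtype]
    congr 1
    ext k
    simp
  have h2 := LinearMap.finrank_range_add_finrank_ker M.mulVecLin
  rw [h1, ← pow_add, Matrix.rank, add_comm, h2, Module.finrank_fintype_fun_eq_card]

lemma sum_norm_mul_translate_le {B : Type*} [Fintype B] [AddGroup B] (χ : B → ℂ) (k : B) :
    ∑ b, ‖χ b‖ * ‖χ (b + k)‖ ≤ ∑ b, ‖χ b‖ ^ 2 := by
  have h1 : ∑ b, ‖χ (b + k)‖ ^ 2 = ∑ b, ‖χ b‖ ^ 2 :=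
    Equiv.sum_comp (Equiv.addRight k) fun b => ‖χ b‖ ^ 2
  have h2 : ∑ b, ‖χ b‖ * ‖χ (b + k)‖ ≤ ∑ b, (‖χ b‖ ^ 2 + ‖χ (b + k)‖ ^ 2) / 2 :=
    sum_le_sum fun b _ => by nlinarith [sq_nonneg (‖χ b‖ - ‖χ (b + k)‖)]
  rw [← Finset.sum_div, sum_add_distrib, h1] at h2
  linarith

section BilinearForm

variable {α β : Type*} [Fintype α] [DecidableEq α] [Fintype β] [DecidableEq β]

/-- The sum of squares of the transform `a ↦ ∑_b χ(b) (-1)^{a·Mb}`. -/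
lemma sum_normSq_signTransform (M : Matrix α β (ZMod 2)) (χ : (β → ZMod 2) → ℂ) :
    ((∑ a : α → ZMod 2, ‖∑ b, χ b * signChar (a ⬝ᵥ M *ᵥ b)‖ ^ 2 : ℝ) : ℂ)
      = 2 ^ Fintype.card α * ∑ k ∈ univ.filter fun k : β → ZMod 2 => M *ᵥ k = 0,
          ∑ b, χ b * (starRingEnd ℂ) (χ (b + k)) := by
  have hchar : ∀ (b k : β → ZMod 2) (a : α → ZMod 2),
      signChar (a ⬝ᵥ M *ᵥ b) * signChar (a ⬝ᵥ M *ᵥ (b + k)) = signChar (a ⬝ᵥ M *ᵥ k) := by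
    intro b k a
    rw [← AddChar.map_add_eq_mul, mulVec_add, dotProduct_add, ← add_assoc,
      CharTwo.add_self_eq_zero, zero_add]
  calc ((∑ a : α → ZMod 2, ‖∑ b, χ b * signChar (a ⬝ᵥ M *ᵥ b)‖ ^ 2 : ℝ) : ℂ)
      = ∑ a : α → ZMod 2, ∑ b, ∑ b', (χ b * signChar (a ⬝ᵥ M *ᵥ b)) *
          ((starRingEnd ℂ) (χ b') * signChar (a ⬝ᵥ M *ᵥ b')) := by
        push_cast
        refine sum_congr rfl fun a _ => ?_
        rw [← Complex.mul_conj', map_sum, sum_mul_sum]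
        simp only [map_mul, star_signChar]
    _ = ∑ a : α → ZMod 2, ∑ b, ∑ k, χ b * (starRingEnd ℂ) (χ (b + k)) *
          signChar (a ⬝ᵥ M *ᵥ k) := by
        refine sum_congr rfl fun a _ => sum_congr rfl fun b _ => ?_
        rw [← Equiv.sum_comp (Equiv.addLeft b)]
        refine sum_congr rfl fun k _ => ?_
        rw [Equiv.coe_addLeft, ← hchar b k a]
        ring
    _ = ∑ k, ∑ b, χ b * (starRingEnd ℂ) (χ (b + k)) *
          ∑ a : α → ZMod 2, signChar (a ⬝ᵥ M *ᵥ k) := by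
        rw [sum_comm, sum_congr rfl fun b _ => sum_comm, sum_comm]
        simp only [mul_sum]
    _ = _ := by
        rw [mul_sum, sum_filter]
        refine sum_congr rfl fun k _ => ?_
        rw [sum_signChar_dotProduct, ← sum_mul]
        split_ifs <;> ring

lemma sum_normSq_signTransform_le (M : Matrix α β (ZMod 2)) (χ : (β → ZMod 2) → ℂ) :
    ∑ a : α → ZMod 2, ‖∑ b, χ b * signChar (a ⬝ᵥ M *ᵥ b)‖ ^ 2
      ≤ 2 ^ Fintype.card α * ((univ.filter fun k : β → ZMod 2 => M *ᵥ k = 0).card *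
          ∑ b, ‖χ b‖ ^ 2) := by
  have h := congrArg norm (sum_normSq_signTransform M χ)
  rw [Complex.norm_real, Real.norm_of_nonneg (by positivity)] at h
  rw [h, norm_mul, norm_pow, Complex.norm_ofNat, ← nsmul_eq_mul]
  gcongr
  refine (norm_sum_le _ _).trans (sum_le_card_nsmul _ _ _ fun k _ => ?_)
  refine (norm_sum_le _ _).trans ?_
  simp only [norm_mul, RCLike.norm_conj]
  exact sum_norm_mul_translate_le χ k

/-- The operator-norm bound for the sign matrix `((-1)^{a·Mb})_{a,b}`. -/
lemma normSq_signForm_le (M : Matrix α β (ZMod 2)) (φ : (α → ZMod 2) → ℂ)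
    (χ : (β → ZMod 2) → ℂ) :
    ‖∑ a, ∑ b, φ a * χ b * signChar (a ⬝ᵥ M *ᵥ b)‖ ^ 2
      ≤ 2 ^ (Fintype.card α + Fintype.card β) * (2 ^ M.rank)⁻¹ *
          ((∑ a, ‖φ a‖ ^ 2) * ∑ b, ‖χ b‖ ^ 2) := by
  have hK : ((univ.filter fun k : β → ZMod 2 => M *ᵥ k = 0).card : ℝ)
      = 2 ^ Fintype.card β * (2 ^ M.rank)⁻¹ := by
    rw [eq_mul_inv_iff_mul_eq₀ (by positivity)]
    exact_mod_cast card_ker_mul_two_pow_rank M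
  have hT := sum_normSq_signTransform_le M χ
  rw [hK] at hT
  have h1 : ‖∑ a, ∑ b, φ a * χ b * signChar (a ⬝ᵥ M *ᵥ b)‖
      ≤ ∑ a, ‖φ a‖ * ‖∑ b, χ b * signChar (a ⬝ᵥ M *ᵥ b)‖ := by
    refine (norm_sum_le _ _).trans (sum_le_sum fun a _ => le_of_eq ?_)
    simp only [mul_assoc, ← mul_sum, norm_mul]
  calc ‖∑ a, ∑ b, φ a * χ b * signChar (a ⬝ᵥ M *ᵥ b)‖ ^ 2
      ≤ (∑ a, ‖φ a‖ * ‖∑ b, χ b * signChar (a ⬝ᵥ M *ᵥ b)‖) ^ 2 := by gcongr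
    _ ≤ (∑ a, ‖φ a‖ ^ 2) * ∑ a : α → ZMod 2, ‖∑ b, χ b * signChar (a ⬝ᵥ M *ᵥ b)‖ ^ 2 :=
        sum_mul_sq_le_sq_mul_sq _ _ _
    _ ≤ (∑ a, ‖φ a‖ ^ 2) * (2 ^ Fintype.card α *
          (2 ^ Fintype.card β * (2 ^ M.rank)⁻¹ * ∑ b, ‖χ b‖ ^ 2)) := by gcongr
    _ = _ := by ring

end BilinearForm

lemma sqrt_two_pow_sq (n : ℕ) : (Real.sqrt 2 ^ n) ^ 2 = 2 ^ n := by
  rw [← pow_mul, mul_comm, pow_mul, Real.sq_sqrt (by norm_num)]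

/-- The edges of `G` with both ends labelled `1` lie inside `A`, inside `V \ A`, or cross. -/
lemma exists_edgeCount_eq_add (G : SimpleGraph V) (A : Finset V) :
    ∃ (f : ({v // v ∈ A} → ZMod 2) → ZMod 2) (h : ({v // v ∉ A} → ZMod 2) → ZMod 2),
      ∀ x, (edgeCount G x : ZMod 2) = f (restrictTo A x) + h (restrictOut A x) +
        restrictTo A x ⬝ᵥ gammaMat G A *ᵥ restrictOut A x := by
  refine ⟨fun a => ((G.edgeFinset.filter fun e => ∀ v ∈ e, ∃ hv : v ∈ A, a ⟨v, hv⟩ = 1).card : ℕ),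
    fun b => ((G.edgeFinset.filter fun e => ∀ v ∈ e, ∃ hv : v ∉ A, b ⟨v, hv⟩ = 1).card : ℕ),
    fun x => ?_⟩
  have hcross : restrictTo A x ⬝ᵥ gammaMat G A *ᵥ restrictOut A x
      = (((univ : Finset ({v // v ∈ A} × {v // v ∉ A})).filter fun p =>
          G.Adj p.1.1 p.2.1 ∧ x p.1.1 = 1 ∧ x p.2.1 = 1).card : ZMod 2) := by
    have hz : ∀ z w : ZMod 2, z * w = if z = 1 ∧ w = 1 then 1 else 0 := by decide
    rw [card_filter, Fintype.sum_prod_type]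
    push_cast
    simp only [dotProduct, mulVec, mul_sum]
    refine sum_congr rfl fun i _ => sum_congr rfl fun j _ => ?_
    simp only [gammaMat, restrictTo, restrictOut, of_apply]
    by_cases hadj : G.Adj i.1 j.1
    · simp [hadj, hz]
    · simp [hadj]
  have hcard : ((univ : Finset ({v // v ∈ A} × {v // v ∉ A})).filter fun p =>
          G.Adj p.1.1 p.2.1 ∧ x p.1.1 = 1 ∧ x p.2.1 = 1).card
      = (G.edgeFinset.filter fun e => (∀ v ∈ e, x v = 1) ∧
          ¬ (∀ v ∈ e, v ∈ A) ∧ ¬ ∀ v ∈ e, v ∉ A).card := by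
    refine card_bij (fun p _ => s(p.1.1, p.2.1)) ?_ ?_ ?_
    · rintro ⟨⟨i, hi⟩, ⟨j, hj⟩⟩ h
      simp_all
    · rintro ⟨⟨i, hi⟩, ⟨j, hj⟩⟩ _ ⟨⟨i', hi'⟩, ⟨j', hj'⟩⟩ _ h
      simp only [Sym2.eq_iff] at h
      grind
    · intro e he
      induction e with | _ u v
      simp only [mem_filter, SimpleGraph.mem_edgeFinset, SimpleGraph.mem_edgeSet,
        Sym2.mem_iff, forall_eq_or_imp, forall_eq] at he
      obtain ⟨hadj, ⟨hu, hv⟩, h1, h2⟩ := he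
      by_cases huA : u ∈ A
      · exact ⟨(⟨u, huA⟩, ⟨v, by tauto⟩), by simp [hadj, hu, hv], rfl⟩
      · exact ⟨(⟨v, by tauto⟩, ⟨u, huA⟩), by simp [hadj.symm, hu, hv], Sym2.eq_swap⟩
  rw [hcross, hcard, ← Nat.cast_add, ← Nat.cast_add]
  congr 1
  simp only [edgeCount, restrictTo, restrictOut]
  rw [← card_union_of_disjoint, ← card_union_of_disjoint]
  · congr 1
    ext e
    induction e with | _ u v
    simp only [mem_union, mem_filter, Sym2.mem_iff, forall_eq_or_imp, forall_eq, exists_prop]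
    tauto
  · rw [Finset.disjoint_left]
    intro e
    induction e with | _ u v
    simp only [mem_union, mem_filter, Sym2.mem_iff, forall_eq_or_imp, forall_eq, exists_prop]
    tauto
  · rw [Finset.disjoint_left]
    intro e
    induction e with | _ u v
    simp only [mem_filter, Sym2.mem_iff, forall_eq_or_imp, forall_eq, exists_prop]
    tauto

/-- Summation over `V → ZMod 2` splits along a bipartition. -/
lemma sum_restrict (A : Finset V) {R : Type*} [AddCommMonoid R]
    (F : ({v // v ∈ A} → ZMod 2) → ({v // v ∉ A} → ZMod 2) → R) :
    ∑ x : V → ZMod 2, F (restrictTo A x) (restrictOut A x) = ∑ a, ∑ b, F a b := by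
  rw [← Fintype.sum_prod_type']
  exact Equiv.sum_comp (Equiv.piEquivPiSubtypeProd (fun v => v ∈ A) fun _ => ZMod 2)
    fun q => F q.1 q.2

lemma IsUnit'.sum_norm_sq {ψ : (V → ZMod 2) → ℂ} (h : IsUnit' ψ) : ∑ x, ‖ψ x‖ ^ 2 = 1 := by
  have h' : (∑ x, (starRingEnd ℂ) (ψ x) * ψ x) = 1 := h
  simp only [Complex.conj_mul'] at h'
  exact_mod_cast h'

/-- A unit product vector across `{A, V \ A}` overlaps the graph state by at most `2^{-r(A)}`. -/
lemma IsProdVec.normSq_graphState_le (G : SimpleGraph V) {A : Finset V}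
    {ψ : (V → ZMod 2) → ℂ} (hψ : IsUnit' ψ) (hprod : IsProdVec A ψ) :
    ‖star (graphState G) ⬝ᵥ ψ‖ ^ 2 ≤ ((2 : ℝ) ^ gRank G A)⁻¹ := by
  obtain ⟨φ, χ, hφχ⟩ := hprod
  obtain ⟨f, h, hfh⟩ := exists_edgeCount_eq_add G A
  have hnorm : (∑ a, ‖φ a‖ ^ 2) * ∑ b, ‖χ b‖ ^ 2 = 1 := by
    rw [sum_mul_sum, ← sum_restrict A fun a b => ‖φ a‖ ^ 2 * ‖χ b‖ ^ 2, ← hψ.sum_norm_sq]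
    simp [hφχ, mul_pow]
  have hov : star (graphState G) ⬝ᵥ ψ
      = (∑ a, ∑ b, (φ a * signChar (f a)) * (χ b * signChar (h b)) *
          signChar (a ⬝ᵥ gammaMat G A *ᵥ b)) / ((Real.sqrt 2 ^ Fintype.card V : ℝ) : ℂ) := by
    rw [← sum_restrict A fun a b => (φ a * signChar (f a)) * (χ b * signChar (h b)) *
          signChar (a ⬝ᵥ gammaMat G A *ᵥ b), sum_div]
    refine sum_congr rfl fun x _ => ?_
    have hg : star (graphState G) x = signChar (f (restrictTo A x)) *
        signChar (h (restrictOut A x)) *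
        signChar (restrictTo A x ⬝ᵥ gammaMat G A *ᵥ restrictOut A x) /
          ((Real.sqrt 2 ^ Fintype.card V : ℝ) : ℂ) := by
      rw [← AddChar.map_add_eq_mul, ← AddChar.map_add_eq_mul, ← hfh, Pi.star_apply, graphState,
        ← signChar_natCast, ← starRingEnd_apply, map_div₀, star_signChar, Complex.conj_ofReal]
    rw [hg, hφχ]
    ring
  have hbound := normSq_signForm_le (gammaMat G A) (fun a => φ a * signChar (f a))
    (fun b => χ b * signChar (h b))
  have hcard : Fintype.card {v // v ∈ A} + Fintype.card {v // v ∉ A} = Fintype.card V := by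
    rw [Fintype.card_subtype_compl, Nat.add_sub_cancel' (Fintype.card_subtype_le _)]
  simp only [norm_mul, norm_signChar, mul_one] at hbound
  rw [hnorm, hcard, mul_one] at hbound
  rw [hov, norm_div, div_pow, Complex.norm_real, Real.norm_of_nonneg (by positivity),
    sqrt_two_pow_sq, div_le_iff₀ (by positivity), mul_comm _ ((2 : ℝ) ^ Fintype.card V)]
  exact hbound

/-- The fidelity of a mixture of pure states with `g`. -/
lemma dotProduct_mixture_mulVec {n : Type*} [Fintype n] {M : ℕ} (p : Fin M → ℝ)
    (ψ : Fin M → n → ℂ) (g : n → ℂ) :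
    star g ⬝ᵥ ((∑ i, (p i : ℂ) • vecMulVec (ψ i) (star (ψ i))) *ᵥ g)
      = ((∑ i, p i * ‖star g ⬝ᵥ ψ i‖ ^ 2 : ℝ) : ℂ) := by
  rw [sum_mulVec, dotProduct_sum]
  push_cast
  refine sum_congr rfl fun i _ => ?_
  have hstar : star (ψ i) ⬝ᵥ g = (starRingEnd ℂ) (star g ⬝ᵥ ψ i) := by
    rw [starRingEnd_apply, star_dotProduct]
  rw [smul_mulVec, vecMulVec_mulVec, dotProduct_smul, dotProduct_smul, hstar,
    ← Complex.mul_conj']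
  simp

/-- Proposition 1, bi-separable case: for a partition `P` of `V` into `m ≥ 2` nonempty parts,
every `P`-bi-separable density matrix `ρ` satisfies
`⟨g, ρ g⟩ ≤ max_A 2^{-r(A)}`, the maximum over nonempty proper unions of parts `A`. -/
theorem biSep_fidelity_le (G : SimpleGraph V) {m : ℕ} (hm : 2 ≤ m)
    (P : Fin m → Finset V) (hP : IsPartition P)
    (ρ : Matrix (V → ZMod 2) (V → ZMod 2) ℂ) (hρd : IsDensity ρ) (hρ : BiSep P ρ) :
    star (graphState G) ⬝ᵥ (ρ *ᵥ graphState G) ≤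
      ((⨆ S : {S : Finset (Fin m) // S.Nonempty ∧ S ≠ univ},
        ((2 : ℝ) ^ gRank G (S.1.biUnion P))⁻¹ : ℝ) : ℂ) := by
  obtain ⟨M, p, ψ, hp, hp1, hψ, hsep, rfl⟩ := hρ
  rw [dotProduct_mixture_mulVec, Complex.real_le_real]
  calc ∑ i, p i * ‖star (graphState G) ⬝ᵥ ψ i‖ ^ 2
      ≤ ∑ i, p i * ⨆ S : {S : Finset (Fin m) // S.Nonempty ∧ S ≠ univ},
          ((2 : ℝ) ^ gRank G (S.1.biUnion P))⁻¹ := by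
        refine sum_le_sum fun i _ => mul_le_mul_of_nonneg_left ?_ (hp i)
        obtain ⟨S, hS, hS', hprod⟩ := hsep i
        exact (hprod.normSq_graphState_le G (hψ i)).trans
          (le_ciSup (f := fun S : {S : Finset (Fin m) // S.Nonempty ∧ S ≠ univ} =>
            ((2 : ℝ) ^ gRank G (S.1.biUnion P))⁻¹) (Set.finite_range _).bddAbove ⟨S, hS, hS'⟩)
    _ = _ := by rw [← sum_mul, hp1, one_mul]
end
end

section
/- (Theorem 1, entanglement witness.) Let G = (V, E) be a finite simple graph with a proper k-coloring with color classes V_1, …, V_k, and let P_l = ∏_{i ∈ V_l} (S_i + I)/2. Let 𝒫 = {A_1, …, A_m} be a partition of V into m ≥ 2 nonempty parts. Then every 𝒫-fully separable density matrix ρ satisfies Σ_{l=1}^k Tr(P_l ρ) ≤ k − 1 + min_A 2^{−r(A)}, where the minimum is over all nonempty proper unions of parts A of 𝒫; equivalently, Tr(W_f ρ) ≥ 0 for the witness W_f = (k − 1 + min_A 2^{−r(A)})·I − Σ_{l=1}^k P_l. -/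
open Matrix Finset
open scoped Classical ComplexOrder

noncomputable section

variable {V : Type} [Fintype V] [DecidableEq V]

/-- The sign character `z ↦ (-1)^z` of `ZMod 2`. -/
def sgn (z : ZMod 2) : ℂ := (-1) ^ z.val

/-- The sum over `ZMod 2` of the values of `x` on the neighborhood of `i`. -/
def nbrSum (G : SimpleGraph V) (i : V) (x : V → ZMod 2) : ZMod 2 :=
  ∑ j ∈ univ.filter (fun j => G.Adj i j), x j

lemma sgn_add (a b : ZMod 2) : sgn (a + b) = sgn a * sgn b := by
  rw [sgn, sgn, sgn, ← pow_add, ZMod.val_add, ← neg_one_pow_eq_pow_mod_two]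

lemma sgn_mul_self (a : ZMod 2) : sgn a * sgn a = 1 := by
  fin_cases a <;> simp [sgn, ZMod.val]

lemma star_sgn (a : ZMod 2) : star (sgn a) = sgn a := by
  simp [sgn]

lemma norm_sgn (a : ZMod 2) : ‖sgn a‖ = 1 := by
  simp [sgn]

lemma sgn_eq_neg_one {a : ZMod 2} (ha : a ≠ 0) : sgn a = -1 := by
  fin_cases a
  · exact absurd rfl ha
  · simp [sgn, ZMod.val]

lemma neg_one_pow_sum_val {ι : Type*} (s : Finset ι) (x : ι → ZMod 2) :
    (-1 : ℂ) ^ (∑ j ∈ s, (x j).val) = sgn (∑ j ∈ s, x j) := by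
  induction s using Finset.induction_on with
  | empty => simp [sgn]
  | insert a s ha ih => rw [sum_insert ha, sum_insert ha, pow_add, ih, sgn_add]; rfl

omit [Fintype V] [DecidableEq V] in
lemma zmod_two_add_cancel (x d : V → ZMod 2) : x + d + d = x := by
  exact funext fun v => by simp [add_assoc, CharTwo.add_self_eq_zero]

omit [Fintype V] in
lemma eq_add_delta_iff (i : V) (x y : V → ZMod 2) : y = x + delta i ↔ x = y + delta i := by
  constructor <;> rintro rfl <;> rw [zmod_two_add_cancel]

omit [DecidableEq V] in
lemma nbrSum_add (G : SimpleGraph V) (i : V) (x y : V → ZMod 2) :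
    nbrSum G i (x + y) = nbrSum G i x + nbrSum G i y := by
  simp [nbrSum, sum_add_distrib]

lemma nbrSum_delta (G : SimpleGraph V) (i j : V) :
    nbrSum G i (delta j) = if G.Adj i j then 1 else 0 := by
  simp [nbrSum, delta]

lemma stab_apply (G : SimpleGraph V) (i : V) (x y : V → ZMod 2) :
    stab G i x y = if y = x + delta i then sgn (nbrSum G i x) else 0 := by
  simp only [stab, of_apply, neg_one_pow_sum_val, nbrSum]

lemma stab_mulVec (G : SimpleGraph V) (i : V) (ψ : (V → ZMod 2) → ℂ) (x : V → ZMod 2) :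
    (stab G i *ᵥ ψ) x = sgn (nbrSum G i x) * ψ (x + delta i) := by
  simp [mulVec, dotProduct, stab_apply, ite_mul]

lemma stab_commute (G : SimpleGraph V) (i j : V) : Commute (stab G i) (stab G j) := by
  refine Matrix.mulVec_injective (funext fun ψ => funext fun x => ?_)
  simp only [← mulVec_mulVec, stab_mulVec, nbrSum_add, nbrSum_delta, sgn_add, G.adj_comm j i,
    add_right_comm x (delta j) (delta i)]
  ring

lemma stab_mul_self (G : SimpleGraph V) (i : V) : stab G i * stab G i = 1 := by
  refine Matrix.mulVec_injective (funext fun ψ => funext fun x => ?_)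
  simp only [← mulVec_mulVec, stab_mulVec, nbrSum_add, nbrSum_delta, G.loopless.irrefl i, if_false,
    add_zero, zmod_two_add_cancel, one_mulVec]
  rw [← mul_assoc, sgn_mul_self, one_mul]

lemma star_stab (G : SimpleGraph V) (i : V) : star (stab G i) = stab G i := by
  ext x y
  rw [star_apply, stab_apply, stab_apply]
  by_cases h : y = x + delta i
  · rw [if_pos h, if_pos ((eq_add_delta_iff i x y).1 h), star_sgn, h, nbrSum_add, nbrSum_delta,
      if_neg (G.loopless.irrefl i), add_zero]
  · rw [if_neg h, if_neg (fun h' => h ((eq_add_delta_iff i x y).2 h')), star_zero]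

/-- The projector `(S_i + I)/2`. -/
def stabHalf (G : SimpleGraph V) (i : V) : Matrix (V → ZMod 2) (V → ZMod 2) ℂ :=
  (2 : ℂ)⁻¹ • (stab G i + 1)

lemma stabProj_eq (G : SimpleGraph V) (W : Finset V) :
    stabProj G W = (W.toList.map (stabHalf G)).prod := rfl

lemma stab_mul_stabHalf (G : SimpleGraph V) (i : V) : stab G i * stabHalf G i = stabHalf G i := by
  rw [stabHalf, mul_smul_comm, mul_add, stab_mul_self, mul_one, add_comm]

lemma stab_commute_stabHalf (G : SimpleGraph V) (i j : V) :
    Commute (stab G i) (stabHalf G j) :=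
  ((stab_commute G i j).add_right (Commute.one_right _)).smul_right _

lemma stabHalf_commute (G : SimpleGraph V) (i j : V) :
    Commute (stabHalf G i) (stabHalf G j) :=
  ((stab_commute_stabHalf G i j).add_left (Commute.one_left _)).smul_left _

lemma isStarProjection_stabHalf (G : SimpleGraph V) (i : V) : IsStarProjection (stabHalf G i) where
  isIdempotentElem := by
    rw [IsIdempotentElem]
    nth_rewrite 1 [stabHalf]
    rw [smul_mul_assoc, add_mul, stab_mul_stabHalf, one_mul, ← two_smul ℂ, smul_smul]
    norm_num
  isSelfAdjoint := by
    rw [IsSelfAdjoint, stabHalf, star_smul, star_add, star_stab, star_one]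
    simp

lemma isStarProjection_mul {R : Type*} [Semigroup R] [StarMul R] {p q : R}
    (hp : IsStarProjection p) (hq : IsStarProjection q) (h : Commute p q) :
    IsStarProjection (p * q) where
  isIdempotentElem := hp.isIdempotentElem.mul_of_commute h hq.isIdempotentElem
  isSelfAdjoint := (IsSelfAdjoint.commute_iff hp.isSelfAdjoint hq.isSelfAdjoint).1 h

lemma isStarProjection_list_prod {R : Type*} [Monoid R] [StarMul R] (L : List R)
    (hL : ∀ p ∈ L, IsStarProjection p) (hc : ∀ p ∈ L, ∀ q ∈ L, Commute p q) :
    IsStarProjection L.prod := by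
  induction L with
  | nil => simp [IsStarProjection.one]
  | cons p L ih =>
    rw [List.prod_cons]
    simp only [List.mem_cons] at hL hc
    exact isStarProjection_mul (hL p (.inl rfl))
      (ih (fun q hq => hL q (.inr hq)) fun q hq r hr => hc q (.inr hq) r (.inr hr))
      (Commute.list_prod_right _ _ fun q hq => hc p (.inl rfl) q (.inr hq))

lemma mul_list_prod_eq {R : Type*} [Monoid R] (s : R) (L : List R)
    (hc : ∀ p ∈ L, Commute s p) (hs : ∃ p ∈ L, s * p = p) : s * L.prod = L.prod := by
  induction L with
  | nil => simp at hs
  | cons p L ih =>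
    rw [List.prod_cons]
    obtain ⟨q, hq, hsq⟩ := hs
    rcases List.mem_cons.1 hq with rfl | hq
    · rw [← mul_assoc, hsq]
    · rw [← mul_assoc, (hc p List.mem_cons_self).eq, mul_assoc,
        ih (fun r hr => hc r (List.mem_cons_of_mem _ hr)) ⟨q, hq, hsq⟩]

lemma isStarProjection_posSemidef {n : Type*} [Fintype n] {E : Matrix n n ℂ}
    (hE : IsStarProjection E) : E.PosSemidef := by
  have h := Matrix.posSemidef_conjTranspose_mul_self E
  rwa [← star_eq_conjTranspose, hE.isSelfAdjoint.star_eq, hE.isIdempotentElem.eq] at h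

/-- For commuting orthogonal projections `p₁, …, p_n`, one has `∑ p_l ≤ (n - 1) I + ∏ p_l`. -/
lemma posSemidef_sub_sum_add_prod {n : Type*} [Fintype n] [DecidableEq n] (L : List (Matrix n n ℂ))
    (hL : ∀ p ∈ L, IsStarProjection p) (hc : ∀ p ∈ L, ∀ q ∈ L, Commute p q) :
    (((L.length : ℂ) - 1) • (1 : Matrix n n ℂ) + L.prod - L.sum).PosSemidef := by
  induction L with
  | nil => simp [Matrix.PosSemidef.zero]
  | cons p L ih =>
    simp only [List.mem_cons] at hL hc
    have hL' := fun q hq => hL q (.inr hq)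
    have hc' := fun q hq r hr => hc q (.inr hq) r (.inr hr)
    have hp := hL p (.inl rfl)
    have hcomm : Commute p L.prod :=
      Commute.list_prod_right _ _ fun q hq => hc p (.inl rfl) q (.inr hq)
    have h := (ih hL' hc').add (isStarProjection_posSemidef (isStarProjection_mul hp.one_sub
      (isStarProjection_list_prod L hL' hc').one_sub
      ((Commute.one_right _).sub_right ((Commute.one_left _).sub_left hcomm))))
    convert h using 1
    rw [List.length_cons, List.prod_cons, List.sum_cons]
    push_cast
    rw [sub_mul, mul_sub, mul_sub, sub_smul, sub_smul, add_smul]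
    simp only [one_mul, mul_one, one_smul]
    abel

lemma stabProj_commute (G : SimpleGraph V) (W W' : Finset V) :
    Commute (stabProj G W) (stabProj G W') := by
  refine Commute.list_prod_left _ _ fun p hp => Commute.list_prod_right _ _ fun q hq => ?_
  obtain ⟨i, -, rfl⟩ := List.mem_map.1 hp
  obtain ⟨j, -, rfl⟩ := List.mem_map.1 hq
  exact stabHalf_commute G i j

lemma stab_commute_stabProj (G : SimpleGraph V) (i : V) (W : Finset V) :
    Commute (stab G i) (stabProj G W) := by
  refine Commute.list_prod_right _ _ fun q hq => ?_
  obtain ⟨j, -, rfl⟩ := List.mem_map.1 hq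
  exact stab_commute_stabHalf G i j

lemma isStarProjection_stabProj (G : SimpleGraph V) (W : Finset V) :
    IsStarProjection (stabProj G W) := by
  refine isStarProjection_list_prod _ (fun p hp => ?_) fun p hp q hq => ?_
  · obtain ⟨i, -, rfl⟩ := List.mem_map.1 hp
    exact isStarProjection_stabHalf G i
  · obtain ⟨i, -, rfl⟩ := List.mem_map.1 hp
    obtain ⟨j, -, rfl⟩ := List.mem_map.1 hq
    exact stabHalf_commute G i j

lemma stab_mul_stabProj (G : SimpleGraph V) {i : V} {W : Finset V} (hi : i ∈ W) :
    stab G i * stabProj G W = stabProj G W := by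
  refine mul_list_prod_eq _ _ (fun q hq => ?_) ⟨stabHalf G i, ?_, stab_mul_stabHalf G i⟩
  · obtain ⟨j, -, rfl⟩ := List.mem_map.1 hq
    exact stab_commute_stabHalf G i j
  · exact List.mem_map.2 ⟨i, mem_toList.2 hi, rfl⟩

lemma sum_glue {R : Type*} [AddCommMonoid R] (A : Finset V) (f : (V → ZMod 2) → R) :
    ∑ x, f x = ∑ a, ∑ b, f (glue A a b) := by
  rw [← Fintype.sum_prod_type' (f := fun a b => f (glue A a b))]
  exact Fintype.sum_equiv (Equiv.piEquivPiSubtypeProd (· ∈ A) fun _ => ZMod 2) _ _ fun x => by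
    congr 1
    exact ((Equiv.piEquivPiSubtypeProd (· ∈ A) fun _ => ZMod 2).symm_apply_apply x).symm

omit [Fintype V] in
lemma restrictTo_glue (A : Finset V) (a : {v // v ∈ A} → ZMod 2) (b : {v // v ∉ A} → ZMod 2) :
    restrictTo A (glue A a b) = a := by
  funext v
  simp [restrictTo, glue, v.2]

omit [Fintype V] in
lemma restrictOut_glue (A : Finset V) (a : {v // v ∈ A} → ZMod 2) (b : {v // v ∉ A} → ZMod 2) :
    restrictOut A (glue A a b) = b := by
  funext v
  simp [restrictOut, glue, v.2]

omit [Fintype V] in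
lemma glue_add_delta (A : Finset V) (a : {v // v ∈ A} → ZMod 2) (b : {v // v ∉ A} → ZMod 2)
    (i : {v // v ∈ A}) :
    glue A (a + Pi.single i 1) b = glue A a b + delta i.1 := by
  funext v
  by_cases hv : v ∈ A
  · simp [glue, hv, delta, Pi.single_apply, Subtype.ext_iff]
  · have : v ≠ i.1 := fun h => hv (h ▸ i.2)
    simp [glue, hv, delta, this]

lemma nbrSum_glue (G : SimpleGraph V) (A : Finset V) (a : {v // v ∈ A} → ZMod 2)
    (b : {v // v ∉ A} → ZMod 2) (i : {v // v ∈ A}) :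
    nbrSum G i (glue A a b) = nbrSum G i (glue A a 0) + (gammaMat G A *ᵥ b) i := by
  have h : glue A a b = glue A a 0 + glue A 0 b := by
    funext v
    by_cases hv : v ∈ A <;> simp [glue, hv]
  rw [h, nbrSum_add]
  congr 1
  rw [nbrSum, sum_filter, ← Fintype.sum_subtype_add_sum_subtype (· ∈ A)]
  simp only [glue, mulVec, dotProduct, gammaMat, of_apply]
  rw [sum_eq_zero fun v _ => by simp [v.2], zero_add]
  refine sum_congr rfl fun v _ => ?_
  simp [v.2]

lemma norm_eq_of_forall_stab (G : SimpleGraph V) {φ : (V → ZMod 2) → ℂ}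
    (hφ : ∀ i, stab G i *ᵥ φ = φ) (x : V → ZMod 2) : ‖φ x‖ = ‖φ 0‖ := by
  have hstep : ∀ i x, ‖φ (x + delta i)‖ = ‖φ x‖ := fun i x => by
    conv_rhs => rw [← hφ i, stab_mulVec, norm_mul, norm_sgn, one_mul]
  have key : ∀ s : Finset V, ‖φ (∑ i ∈ s, delta i)‖ = ‖φ 0‖ := fun s => by
    induction s using Finset.induction_on with
    | empty => simp
    | insert a s ha ih => rw [sum_insert ha, add_comm, hstep, ih]
  rw [← key (univ.filter fun i => x i = 1)]
  congr 2
  funext v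
  rw [Finset.sum_apply, sum_filter]
  simp only [delta]
  have hz : ∀ z : ZMod 2, z = if z = 1 then 1 else 0 := by decide
  rw [sum_eq_single v (fun i _ hi => by simp [hi.symm]) (by simp), if_pos rfl]
  exact hz (x v)

/-- The Gram matrix of the slices `φ(·, b)` of a stabilized vector is supported on the pairs
`b, b'` with `Γ b = Γ b'`. -/
lemma norm_sum_slice_mul_star_le (G : SimpleGraph V) {φ : (V → ZMod 2) → ℂ}
    (hφ : ∀ i, stab G i *ᵥ φ = φ) (A : Finset V) (b b' : {v // v ∉ A} → ZMod 2) :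
    ‖∑ a, star (φ (glue A a b)) * φ (glue A a b')‖ ≤
      if gammaMat G A *ᵥ b = gammaMat G A *ᵥ b' then (2 : ℝ) ^ A.card * ‖φ 0‖ ^ 2 else 0 := by
  split_ifs with h
  · refine (norm_sum_le _ _).trans_eq ?_
    simp [norm_eq_of_forall_stab G hφ, sq]
  · obtain ⟨i, hi⟩ := Function.ne_iff.1 h
    rw [norm_le_zero_iff]
    have hsgn : sgn ((gammaMat G A *ᵥ b) i) * sgn ((gammaMat G A *ᵥ b') i) = -1 := by
      rw [← sgn_add]
      exact sgn_eq_neg_one fun h0 => hi (CharTwo.add_eq_zero.1 h0)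
    have hshift : ∀ c a, φ (glue A a c) = sgn (nbrSum G i (glue A a 0)) *
        sgn ((gammaMat G A *ᵥ c) i) * φ (glue A (a + Pi.single i 1) c) := fun c a => by
      rw [glue_add_delta, ← sgn_add, ← nbrSum_glue, ← stab_mulVec, hφ]
    have hneg : ∀ a, star (φ (glue A a b)) * φ (glue A a b') =
        -(star (φ (glue A (a + Pi.single i 1) b)) * φ (glue A (a + Pi.single i 1) b')) :=
      fun a => by
        rw [hshift b a, hshift b' a, star_mul', star_mul', star_sgn, star_sgn]
        linear_combination (star (φ (glue A (a + Pi.single i 1) b)) *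
          φ (glue A (a + Pi.single i 1) b')) *
          (sgn ((gammaMat G A *ᵥ b) i) * sgn ((gammaMat G A *ᵥ b') i) *
            sgn_mul_self (nbrSum G i (glue A a 0)) + hsgn)
    have hsum := Fintype.sum_congr _ _ hneg
    have hinv := Equiv.sum_comp (Equiv.addRight (Pi.single i (1 : ZMod 2)))
      fun a => star (φ (glue A a b)) * φ (glue A a b')
    simp only [Equiv.coe_addRight] at hinv
    rw [sum_neg_distrib, hinv] at hsum
    exact self_eq_neg.1 hsum

lemma card_fiber_mul_two_pow_rank {m n : Type*} [Fintype m] [Fintype n] [DecidableEq n]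
    (M : Matrix m n (ZMod 2)) (c : n → ZMod 2) :
    (univ.filter fun b => M *ᵥ c = M *ᵥ b).card * 2 ^ M.rank = 2 ^ Fintype.card n := by
  have hker : (univ.filter fun b => M *ᵥ c = M *ᵥ b).card =
      Fintype.card (LinearMap.ker M.mulVecLin) := by
    rw [← Fintype.card_coe]
    refine Fintype.card_congr ⟨fun b => ⟨b.1 - c, ?_⟩, fun b => ⟨b.1 + c, ?_⟩, ?_, ?_⟩
    · have := (mem_filter.1 b.2).2
      simp [mulVec_sub, this]
    · have := LinearMap.mem_ker.1 b.2
      rw [mulVecLin_apply] at this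
      simp [mulVec_add, this]
    · intro b; simp
    · intro b; simp
  rw [hker, Module.card_eq_pow_finrank (K := ZMod 2), ZMod.card, Matrix.rank, ← pow_add, add_comm,
    LinearMap.finrank_range_add_finrank_ker, Module.finrank_fintype_fun_eq_card]

lemma sum_norm_sq_slice_le (G : SimpleGraph V) {φ : (V → ZMod 2) → ℂ}
    (hφ : ∀ i, stab G i *ᵥ φ = φ) (A : Finset V) (β : ({v // v ∉ A} → ZMod 2) → ℂ) :
    ∑ a, ‖∑ b, star (β b) * φ (glue A a b)‖ ^ 2 ≤
      ((2 : ℝ) ^ gRank G A)⁻¹ * (∑ b, ‖β b‖ ^ 2) * (2 ^ Fintype.card V * ‖φ 0‖ ^ 2) := by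
  set c : ℝ := 2 ^ A.card * ‖φ 0‖ ^ 2 with hc
  set Γ := gammaMat G A with hΓ
  have hexp : ((∑ a, ‖∑ b, star (β b) * φ (glue A a b)‖ ^ 2 : ℝ) : ℂ) =
      ∑ b, ∑ b', β b * star (β b') * ∑ a, star (φ (glue A a b)) * φ (glue A a b') := by
    push_cast
    simp_rw [← Complex.conj_mul', map_sum, sum_mul_sum, mul_sum]
    rw [sum_comm]
    refine sum_congr rfl fun b _ => ?_
    rw [sum_comm]
    refine sum_congr rfl fun b' _ => sum_congr rfl fun a _ => ?_
    simp only [map_mul, RCLike.star_def, Complex.conj_conj]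
    ring
  have hsym : ∑ b, ∑ b', (if Γ *ᵥ b = Γ *ᵥ b' then ‖β b'‖ ^ 2 else 0) =
      ∑ b, ∑ b', if Γ *ᵥ b = Γ *ᵥ b' then ‖β b‖ ^ 2 else 0 := by
    rw [sum_comm]
    simp only [eq_comm]
  have hfib : ∀ b, (∑ b', if Γ *ᵥ b = Γ *ᵥ b' then ‖β b‖ ^ 2 else 0) =
      2 ^ Fintype.card {v // v ∉ A} * ((2 : ℝ) ^ gRank G A)⁻¹ * ‖β b‖ ^ 2 := fun b => by
    have h := card_fiber_mul_two_pow_rank Γ b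
    have h' : ((univ.filter fun b' => Γ *ᵥ b = Γ *ᵥ b').card : ℝ) * 2 ^ gRank G A =
        2 ^ Fintype.card {v // v ∉ A} := by exact_mod_cast h
    rw [← sum_filter, sum_const, nsmul_eq_mul, ← h']
    field_simp
  have hcard : (2 : ℝ) ^ Fintype.card V = 2 ^ Fintype.card {v // v ∉ A} * 2 ^ A.card := by
    rw [← pow_add, Fintype.card_subtype_compl, Fintype.card_coe,
      Nat.sub_add_cancel (card_le_univ A)]
  calc ∑ a, ‖∑ b, star (β b) * φ (glue A a b)‖ ^ 2
      = ‖((∑ a, ‖∑ b, star (β b) * φ (glue A a b)‖ ^ 2 : ℝ) : ℂ)‖ := by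
        rw [Complex.norm_real, Real.norm_of_nonneg (by positivity)]
    _ ≤ ∑ b, ∑ b', ‖β b‖ * ‖β b'‖ * (if Γ *ᵥ b = Γ *ᵥ b' then c else 0) := by
        rw [hexp]
        refine (norm_sum_le _ _).trans (sum_le_sum fun b _ => (norm_sum_le _ _).trans
          (sum_le_sum fun b' _ => ?_))
        rw [norm_mul, norm_mul, norm_star]
        gcongr
        exact norm_sum_slice_mul_star_le G hφ A b b'
    _ ≤ ∑ b, ∑ b', c / 2 * ((if Γ *ᵥ b = Γ *ᵥ b' then ‖β b‖ ^ 2 else 0) +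
          if Γ *ᵥ b = Γ *ᵥ b' then ‖β b'‖ ^ 2 else 0) := by
        refine sum_le_sum fun b _ => sum_le_sum fun b' _ => ?_
        split_ifs
        · have hc0 : 0 ≤ c := by positivity
          nlinarith [mul_nonneg hc0 (sq_nonneg (‖β b‖ - ‖β b'‖))]
        · simp
    _ = c * ∑ b, ∑ b', if Γ *ᵥ b = Γ *ᵥ b' then ‖β b‖ ^ 2 else 0 := by
        simp_rw [← mul_sum, sum_add_distrib]
        rw [hsym]
        ring
    _ = _ := by
        simp_rw [hfib]
        rw [← mul_sum, hcard, hc]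
        ring

/-- A vector stabilized by all `S_i` has squared Schmidt coefficients at most `2^{-r(A)}` times its
squared norm across the bipartition `{A, V \ A}`. -/
lemma norm_sq_dotProduct_le (G : SimpleGraph V) {φ ψ : (V → ZMod 2) → ℂ}
    (hφ : ∀ i, stab G i *ᵥ φ = φ) {A : Finset V} (hψ : IsProdVec A ψ) :
    ‖star ψ ⬝ᵥ φ‖ ^ 2 ≤
      ((2 : ℝ) ^ gRank G A)⁻¹ * (∑ x, ‖ψ x‖ ^ 2) * ∑ x, ‖φ x‖ ^ 2 := by
  obtain ⟨α, β, h⟩ := hψ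
  have hdot : star ψ ⬝ᵥ φ = ∑ a, star (α a) * ∑ b, star (β b) * φ (glue A a b) := by
    rw [dotProduct, sum_glue A]
    simp only [Pi.star_apply, h, restrictTo_glue, restrictOut_glue, star_mul', mul_sum, mul_assoc]
  have hψn : ∑ x, ‖ψ x‖ ^ 2 = (∑ a, ‖α a‖ ^ 2) * ∑ b, ‖β b‖ ^ 2 := by
    rw [sum_glue A, sum_mul_sum]
    simp only [h, restrictTo_glue, restrictOut_glue, norm_mul, mul_pow]
  have hφn : ∑ x, ‖φ x‖ ^ 2 = 2 ^ Fintype.card V * ‖φ 0‖ ^ 2 := by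
    simp [norm_eq_of_forall_stab G hφ]
  rw [hdot, hψn, hφn]
  calc _ ≤ (∑ a, ‖α a‖ * ‖∑ b, star (β b) * φ (glue A a b)‖) ^ 2 := by
        gcongr
        refine (norm_sum_le _ _).trans_eq ?_
        simp only [norm_mul, norm_star]
    _ ≤ (∑ a, ‖α a‖ ^ 2) * ∑ a, ‖∑ b, star (β b) * φ (glue A a b)‖ ^ 2 :=
        sum_mul_sq_le_sq_mul_sq _ _ _
    _ ≤ (∑ a, ‖α a‖ ^ 2) * (((2 : ℝ) ^ gRank G A)⁻¹ * (∑ b, ‖β b‖ ^ 2) *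
          (2 ^ Fintype.card V * ‖φ 0‖ ^ 2)) := by
        gcongr
        exact sum_norm_sq_slice_le G hφ A β
    _ = _ := by ring

lemma star_dotProduct_self {n : Type*} [Fintype n] (φ : n → ℂ) :
    star φ ⬝ᵥ φ = ((∑ x, ‖φ x‖ ^ 2 : ℝ) : ℂ) := by
  simp [dotProduct, Complex.conj_mul']

lemma star_dotProduct_projection_mulVec_le (G : SimpleGraph V)
    {E : Matrix (V → ZMod 2) (V → ZMod 2) ℂ} (hE : IsStarProjection E)
    (hS : ∀ i, stab G i * E = E) {A : Finset V} {ψ : (V → ZMod 2) → ℂ} (hψ : IsProdVec A ψ)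
    (hunit : IsUnit' ψ) :
    star ψ ⬝ᵥ E *ᵥ ψ ≤ ((((2 : ℝ) ^ gRank G A)⁻¹ : ℝ) : ℂ) := by
  set φ := E *ᵥ ψ with hφ
  have hstab : ∀ i, stab G i *ᵥ φ = φ := fun i => by rw [hφ, mulVec_mulVec, hS]
  have hself : star ψ ⬝ᵥ φ = ((∑ x, ‖φ x‖ ^ 2 : ℝ) : ℂ) := by
    rw [← star_dotProduct_self, hφ, star_mulVec, ← star_eq_conjTranspose,
      hE.isSelfAdjoint.star_eq, ← dotProduct_mulVec, mulVec_mulVec, hE.isIdempotentElem.eq]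
  have hone : ∑ x, ‖ψ x‖ ^ 2 = 1 := by
    have := hunit
    rw [IsUnit', star_dotProduct_self] at this
    exact_mod_cast this
  have h := norm_sq_dotProduct_le G hstab hψ
  rw [hone, mul_one, hself, Complex.norm_real, Real.norm_of_nonneg (by positivity)] at h
  rw [hself, Complex.real_le_real]
  rcases (show 0 ≤ ∑ x, ‖φ x‖ ^ 2 by positivity).eq_or_lt with h0 | h0
  · rw [← h0]
    positivity
  · exact le_of_mul_le_mul_right (by rwa [← sq]) h0

lemma FullSepPure.isProdVec {m : ℕ} {P : Fin m → Finset V} (hP : IsPartition P)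
    {ψ : (V → ZMod 2) → ℂ} (hψ : FullSepPure P ψ) (S : Finset (Fin m)) :
    IsProdVec (S.biUnion P) ψ := by
  obtain ⟨φ, hφ⟩ := hψ
  refine ⟨fun a => ∏ t ∈ S, φ t (restrictTo (P t) (glue _ a 0)),
    fun b => ∏ t ∈ Sᶜ, φ t (restrictTo (P t) (glue _ 0 b)), fun x => ?_⟩
  rw [hφ, ← prod_mul_prod_compl S]
  congr 1
  · refine prod_congr rfl fun t ht => congrArg (φ t) (funext fun v => ?_)
    have hv : v.1 ∈ S.biUnion P := mem_biUnion.2 ⟨t, ht, v.2⟩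
    simp only [restrictTo, glue, dif_pos hv]
  · refine prod_congr rfl fun t ht => congrArg (φ t) (funext fun v => ?_)
    have hv : v.1 ∉ S.biUnion P := fun hmem => by
      obtain ⟨s, hs, hvs⟩ := mem_biUnion.1 hmem
      have hne : s ≠ t := fun h => mem_compl.1 ht (h ▸ hs)
      exact disjoint_left.1 (hP.2.1 s t hne) hvs v.2
    simp only [restrictTo, restrictOut, glue, dif_neg hv]

/-- The witness inequality for a pure unit vector which is a product across `{A, V \ A}`. -/
lemma sum_star_dotProduct_stabProj_le (G : SimpleGraph V) {k : ℕ} (C : Fin k → Finset V)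
    (hC : univ.biUnion C = univ) {A : Finset V} {ψ : (V → ZMod 2) → ℂ} (hψ : IsProdVec A ψ)
    (hunit : IsUnit' ψ) :
    ∑ l, star ψ ⬝ᵥ stabProj G (C l) *ᵥ ψ ≤
      (((k : ℝ) - 1 + ((2 : ℝ) ^ gRank G A)⁻¹ : ℝ) : ℂ) := by
  set L := List.ofFn fun l => stabProj G (C l) with hL
  have hproj : ∀ p ∈ L, IsStarProjection p := fun p hp => by
    obtain ⟨l, rfl⟩ := (List.mem_ofFn' _ _).1 hp
    exact isStarProjection_stabProj G _
  have hcomm : ∀ p ∈ L, ∀ q ∈ L, Commute p q := fun p hp q hq => by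
    obtain ⟨l, rfl⟩ := (List.mem_ofFn' _ _).1 hp
    obtain ⟨l', rfl⟩ := (List.mem_ofFn' _ _).1 hq
    exact stabProj_commute G _ _
  have hS : ∀ i, stab G i * L.prod = L.prod := fun i => by
    obtain ⟨l, -, hl⟩ := mem_biUnion.1 (hC ▸ mem_univ i : i ∈ univ.biUnion C)
    refine mul_list_prod_eq _ _ (fun p hp => ?_)
      ⟨_, (List.mem_ofFn' _ _).2 ⟨l, rfl⟩, stab_mul_stabProj G hl⟩
    obtain ⟨l', rfl⟩ := (List.mem_ofFn' _ _).1 hp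
    exact stab_commute_stabProj G i _
  have hprod := star_dotProduct_projection_mulVec_le G
    (isStarProjection_list_prod L hproj hcomm) hS hψ hunit
  have hpos := (posSemidef_sub_sum_add_prod L hproj hcomm).dotProduct_mulVec_nonneg ψ
  rw [sub_mulVec, add_mulVec, dotProduct_sub, dotProduct_add, smul_mulVec, one_mulVec,
    dotProduct_smul, show star ψ ⬝ᵥ ψ = 1 from hunit, sub_nonneg] at hpos
  have hsum : L.sum = ∑ l, stabProj G (C l) := List.sum_ofFn
  rw [hsum, sum_mulVec, dotProduct_sum] at hpos
  refine hpos.trans ?_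
  push_cast at hprod ⊢
  rw [smul_eq_mul, mul_one, hL, List.length_ofFn]
  gcongr

/-- Theorem 1, entanglement witness: for a proper `k`-coloring `C` of `G` with
projectors `P_l = ∏_{i ∈ C l} (S_i + I)/2`, and a partition `P` of `V` into `m ≥ 2`
nonempty parts, every `P`-fully separable density matrix `ρ` satisfies
`∑_l Tr(P_l ρ) ≤ k - 1 + min_A 2^{-r(A)}`. -/
theorem witness_fullSep (G : SimpleGraph V) {k : ℕ} (C : Fin k → Finset V)
    (hC : IsColoring G C) {m : ℕ} (hm : 2 ≤ m)
    (P : Fin m → Finset V) (hP : IsPartition P)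
    (ρ : Matrix (V → ZMod 2) (V → ZMod 2) ℂ) (hρd : IsDensity ρ) (hρ : FullSep P ρ) :
    ∑ l, (stabProj G (C l) * ρ).trace ≤
      (((k : ℝ) - 1 + ⨅ S : {S : Finset (Fin m) // S.Nonempty ∧ S ≠ univ},
        ((2 : ℝ) ^ gRank G (S.1.biUnion P))⁻¹ : ℝ) : ℂ) := by
  obtain ⟨M, p, ψ, hp, hp1, hunit, hsep, rfl⟩ := hρ
  have hne : Nonempty {S : Finset (Fin m) // S.Nonempty ∧ S ≠ univ} :=
    ⟨{⟨0, by omega⟩}, singleton_nonempty _, fun h => by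
      have := congrArg card h
      simp at this
      omega⟩
  obtain ⟨S, hS⟩ := exists_eq_ciInf_of_finite
    (f := fun S : {S : Finset (Fin m) // S.Nonempty ∧ S ≠ univ} =>
      ((2 : ℝ) ^ gRank G (S.1.biUnion P))⁻¹)
  rw [← hS]
  set B : ℝ := (k : ℝ) - 1 + ((2 : ℝ) ^ gRank G (S.1.biUnion P))⁻¹
  have htr : ∑ l, (stabProj G (C l) * ∑ i, (p i : ℂ) • vecMulVec (ψ i) (star (ψ i))).trace =
      ∑ i, (p i : ℂ) * ∑ l, star (ψ i) ⬝ᵥ stabProj G (C l) *ᵥ ψ i := by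
    simp_rw [Matrix.mul_sum, trace_sum, mul_smul_comm, trace_smul, mul_vecMulVec, trace_vecMulVec,
      smul_eq_mul, mul_sum, dotProduct_comm (star _)]
    exact sum_comm
  calc _ = _ := htr
    _ ≤ ∑ i, (p i : ℂ) * (B : ℂ) := sum_le_sum fun i _ => mul_le_mul_of_nonneg_left
        (sum_star_dotProduct_stabProj_le G C hC.2.1 ((hsep i).isProdVec hP S.1) (hunit i))
        (by exact_mod_cast hp i)
    _ = (B : ℂ) := by
        rw [← sum_mul]
        norm_cast
        rw [hp1, one_mul]
end
end
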